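/- The bilinear form (E_K, FC_b(C_0(ℝ^d),Γ)) is closable on L²(Γ,μ): for every sequence (F_n) in FC_b(C_0(ℝ^d),Γ) such that F_n → 0 in L²(Γ,μ) and E_K(F_n − F_m, F_n − F_m) → 0 as n,m → ∞, one has E_K(F_n, F_n) → 0 as n → ∞. -/

import Mathlib

open MeasureTheory Set Filter
open scoped ENNReal NNReal BigOperators Topology Classical

noncomputable section

abbrev EucSp (d : ℕ) := EuclideanSpace ℝ (Fin d)

/-- The configuration space `Γ` over `ℝ^d`: locally finite subsets. -/
def Config (d : ℕ) : Type :=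
  {γ : Set (EucSp d) // ∀ Λ : Set (EucSp d), IsCompact Λ → (γ ∩ Λ).Finite}

/-- The σ-algebra on `Γ` generated by the maps `γ ↦ |γ ∩ B|`, `B` Borel. -/
instance Config.instMS (d : ℕ) : MeasurableSpace (Config d) :=
  ⨆ (B : Set (EucSp d)) (_ : MeasurableSet B),
    MeasurableSpace.comap (fun γ : Config d => (γ.1 ∩ B).encard) (⊤ : MeasurableSpace ℕ∞)

/-- `γ ∪ {x}`. -/
def Config.ins {d : ℕ} (γ : Config d) (x : EucSp d) : Config d :=
  ⟨insert x γ.1, fun Λ hΛ => ((γ.2 Λ hΛ).insert x).subset fun y hy => by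
    rcases hy with ⟨h1, h2⟩
    rcases h1 with rfl | h1
    · exact Set.mem_insert _ _
    · exact Set.mem_insert_of_mem _ ⟨h1, h2⟩⟩

/-- `γ ∖ {x}`. -/
def Config.del {d : ℕ} (γ : Config d) (x : EucSp d) : Config d :=
  ⟨γ.1 \ {x}, fun Λ hΛ => (γ.2 Λ hΛ).subset fun y hy => ⟨hy.1.1, hy.2⟩⟩

/-- The pairing `⟨f, γ⟩ = ∑_{x ∈ γ} f x`. -/
def cpair {d : ℕ} (f : EucSp d → ℝ) (γ : Config d) : ℝ := ∑' x : γ.1, f x.1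

/-- `exp : [-∞,∞] → [0,∞]`. -/
def eexp (x : EReal) : ℝ≥0∞ :=
  if x = ⊤ then ⊤ else if x = ⊥ then 0 else ENNReal.ofReal (Real.exp x.toReal)

/-- real-valued exponential of an extended real (with `exp(±∞)` sent to junk value `0`). -/
def rexp (x : EReal) : ℝ := (eexp x).toReal

/-- The relative energy `E(x,γ) = ∑_{y ∈ γ} φ(x-y)` if absolutely convergent, `+∞` otherwise. -/
def energy {d : ℕ} (φ : EucSp d → EReal) (x : EucSp d) (γ : Set (EucSp d)) : EReal :=
  if (∀ y ∈ γ, φ (x - y) ≠ ⊤) ∧ Summable (fun y : γ => (φ (x - y.1)).toReal)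
  then (((∑' y : γ, (φ (x - y.1)).toReal) : ℝ) : EReal)
  else ⊤

/-- `∑_{u ∈ γ} φ(u)` if absolutely convergent, `+∞` otherwise. -/
def totPhi {d : ℕ} (φ : EucSp d → EReal) (γ : Set (EucSp d)) : EReal :=
  if (∀ y ∈ γ, φ y ≠ ⊤) ∧ Summable (fun y : γ => (φ y.1).toReal)
  then (((∑' y : γ, (φ y.1).toReal) : ℝ) : EReal)
  else ⊤

/-- A pair potential: Borel, even, with `φ(x) ∈ ℝ` off the origin. -/
structure IsPairPotential {d : ℕ} (φ : EucSp d → EReal) : Prop where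
  meas : Measurable φ
  even : ∀ x : EucSp d, x ≠ 0 → φ (-x) = φ x
  finite_off : ∀ x : EucSp d, x ≠ 0 → φ x ≠ ⊤
  ne_bot : ∀ x, φ x ≠ ⊥

/-- Stability (S): `∑_{{x,y} ⊆ η} φ(x-y) ≥ -B|η|` for all finite `η`
(stated with the sum over ordered pairs, which doubles both sides). -/
def Stable {d : ℕ} (φ : EucSp d → EReal) (B : ℝ) : Prop :=
  ∀ η : Finset (EucSp d),
    ((-(2 * B * η.card) : ℝ) : EReal) ≤ ∑ p ∈ η.offDiag, φ (p.1 - p.2)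

/-- Low activity–high temperature (LA-HT): `∫ |e^{-φ} - 1| z dx < (2 e^{1+2B})⁻¹`. -/
def LAHT {d : ℕ} (φ : EucSp d → EReal) (z B : ℝ) : Prop :=
  ∫⁻ x : EucSp d, ENNReal.ofReal (|rexp (-(φ x)) - 1| * z)
    < ENNReal.ofReal (2 * Real.exp (1 + 2 * B))⁻¹

/-- The Georgii–Nguyen–Zessin identity characterizing `μ ∈ G(z,φ)`. -/
def GNZ {d : ℕ} (z : ℝ) (φ : EucSp d → EReal) (μ : Measure (Config d)) : Prop :=
  ∀ F : Config d → EucSp d → ℝ≥0∞,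
    Measurable (Function.uncurry F) →
    ∫⁻ γ, ∑' x : γ.1, F γ x.1 ∂μ
      = ∫⁻ γ, ∫⁻ x, ENNReal.ofReal z * eexp (-(energy φ x γ.1)) * F (γ.ins x) x ∂volume ∂μ


/-- Ordered `n`-tuples of distinct points of `γ`. -/
def injTuples {d : ℕ} (n : ℕ) (γ : Set (EucSp d)) : Set (Fin n → EucSp d) :=
  {p | Function.Injective p ∧ ∀ i, p i ∈ γ}

/-- `(k_μ^{(n)})` is the family of correlation functions of `μ`: each `k n` is measurable,
nonnegative and symmetric, and for every measurable symmetric `f : (ℝ^d)^n → [0,∞]`,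
`∫_Γ ∑_{{x_1,…,x_n} ⊆ γ} f dμ = (1/n!) ∫ f·kₙ dx` (stated equivalently via the sum over
ordered tuples of distinct points, which absorbs the factor `1/n!`). -/
def HasCorrFns {d : ℕ} (μ : Measure (Config d)) (k : ∀ n : ℕ, (Fin n → EucSp d) → ℝ) : Prop :=
  (∀ n : ℕ, Measurable (k n) ∧ (∀ x, 0 ≤ k n x) ∧
      ∀ (σ : Equiv.Perm (Fin n)) (x : Fin n → EucSp d), k n (x ∘ σ) = k n x) ∧
  ∀ n : ℕ, 0 < n → ∀ f : (Fin n → EucSp d) → ℝ≥0∞, Measurable f →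
    (∀ (σ : Equiv.Perm (Fin n)) (x : Fin n → EucSp d), f (x ∘ σ) = f x) →
    ∫⁻ γ, ∑' p : injTuples n γ.1, f p.1 ∂μ
      = ∫⁻ x : Fin n → EucSp d, f x * ENNReal.ofReal (k n x)

/-- The Ruelle bound `k^{(n)} ≤ ξⁿ`. -/
def RuelleBound {d : ℕ} (k : ∀ n : ℕ, (Fin n → EucSp d) → ℝ) (ξ : ℝ) : Prop :=
  ∀ n : ℕ, 0 < n → ∀ x : Fin n → EucSp d, k n x ≤ ξ ^ n

/-- Translation invariance of a family of functions on tuples. -/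
def TransInvFns {d : ℕ} (k : ∀ n : ℕ, (Fin n → EucSp d) → ℝ) : Prop :=
  ∀ (n : ℕ) (a : EucSp d) (x : Fin n → EucSp d), k n (fun i => x i + a) = k n x

/-- `P` is a partition of `{0,…,n-1}` into nonempty pairwise disjoint blocks. -/
def IsPartOfUniv {n : ℕ} (P : Finset (Finset (Fin n))) : Prop :=
  (∀ b ∈ P, b.Nonempty) ∧ (P : Set (Finset (Fin n))).PairwiseDisjoint id ∧
    P.sup id = Finset.univ

/-- `u` is the family of Ursell functions of `k`:
`k(η) = ∑ u(η_1) ⋯ u(η_j)`, summing over all partitions of `η`. -/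
def IsUrsell {d : ℕ} (k u : ∀ n : ℕ, (Fin n → EucSp d) → ℝ) : Prop :=
  ∀ n : ℕ, 0 < n → ∀ x : Fin n → EucSp d,
    k n x = ∑ P : Finset (Finset (Fin n)),
      if IsPartOfUniv P then ∏ b ∈ P, u b.card (fun i => x (b.orderIsoOfFin rfl i).1) else 0

/-- `f ∈ C_0(ℝ^d)`: continuous with compact support. -/
def IsC0 {d : ℕ} (f : EucSp d → ℝ) : Prop := Continuous f ∧ HasCompactSupport f

/-- Cylinder functions `FC_b(C_0(ℝ^d),Γ)`. -/
def Cyl {d : ℕ} (F : Config d → ℝ) : Prop :=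
  ∃ (N : ℕ) (f : Fin N → EucSp d → ℝ) (g : (Fin N → ℝ) → ℝ),
    (∀ i, IsC0 (f i)) ∧ Continuous g ∧ (∃ C, ∀ y, |g y| ≤ C) ∧
    ∀ γ, F γ = g fun i => cpair (f i) γ

/-- `(D_x^- F)(γ) = F(γ∖x) - F(γ)`. -/
def Dminus {d : ℕ} (F : Config d → ℝ) (x : EucSp d) (γ : Config d) : ℝ := F (γ.del x) - F γ

/-- `(D_x^+ F)(γ) = F(γ∪x) - F(γ)`. -/
def Dplus {d : ℕ} (F : Config d → ℝ) (x : EucSp d) (γ : Config d) : ℝ := F (γ.ins x) - F γ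

/-- `(D_{xy}^{-+} F)(γ) = F(γ∖x∪y) - F(γ)`. -/
def Dpm {d : ℕ} (F : Config d → ℝ) (x y : EucSp d) (γ : Config d) : ℝ :=
  F ((γ.del x).ins y) - F γ

/-- The Glauber bilinear form `E_G`. -/
def glauberForm {d : ℕ} (s : ℝ) (φ : EucSp d → EReal) (μ : Measure (Config d))
    (F G : Config d → ℝ) : ℝ :=
  ∫ γ, (∑' x : γ.1,
      rexp ((s : EReal) * energy φ x.1 (γ.1 \ {x.1})) * Dminus F x.1 γ * Dminus G x.1 γ) ∂μ

/-- The Kawasaki bilinear form `E_K`. -/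
def kawasakiForm {d : ℕ} (s : ℝ) (a : EucSp d → ℝ) (φ : EucSp d → EReal)
    (μ : Measure (Config d)) (F G : Config d → ℝ) : ℝ :=
  (1 / 2) * ∫ γ, (∑' x : γ.1, ∫ y : EucSp d,
      a (x.1 - y) *
        rexp ((s : EReal) * energy φ x.1 (γ.1 \ {x.1}) +
          ((s - 1 : ℝ) : EReal) * energy φ y (γ.1 \ {x.1})) *
        Dpm F x.1 y γ * Dpm G x.1 y γ) ∂μ

/-- The Glauber generator `H_G`. -/
def HG {d : ℕ} (s z : ℝ) (φ : EucSp d → EReal) (F : Config d → ℝ) (γ : Config d) : ℝ :=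
  -(∑' x : γ.1, rexp ((s : EReal) * energy φ x.1 (γ.1 \ {x.1})) * Dminus F x.1 γ)
    - ∫ x : EucSp d, z * rexp (((s - 1 : ℝ) : EReal) * energy φ x γ.1) * Dplus F x γ

/-- The Kawasaki generator `H_K`. -/
def HK {d : ℕ} (s : ℝ) (a : EucSp d → ℝ) (φ : EucSp d → EReal) (F : Config d → ℝ)
    (γ : Config d) : ℝ :=
  -(∑' x : γ.1, ∫ y : EucSp d,
      a (x.1 - y) * rexp ((s : EReal) * energy φ x.1 (γ.1 \ {x.1}) +
        ((s - 1 : ℝ) : EReal) * energy φ y (γ.1 \ {x.1})) * Dpm F x.1 y γ)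

/-- The scaled jump kernel `a_ε(x) = ε^d a(ε x)`. -/
def aScaled {d : ℕ} (a : EucSp d → ℝ) (ε : ℝ) (x : EucSp d) : ℝ := ε ^ d * a (ε • x)

/-- `H_ε^-` (death part of the Kawasaki generator with kernel `aa`). -/
def HepsMinus {d : ℕ} (s : ℝ) (aa : EucSp d → ℝ) (φ : EucSp d → EReal)
    (F : Config d → ℝ) (γ : Config d) : ℝ :=
  -(∑' x : γ.1, Dminus F x.1 γ * ∫ y : EucSp d,
      aa (x.1 - y) * rexp ((s : EReal) * energy φ x.1 (γ.1 \ {x.1}) +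
        ((s - 1 : ℝ) : EReal) * energy φ y (γ.1 \ {x.1})))

/-- `H_ε^+` (birth part of the Kawasaki generator with kernel `aa`). -/
def HepsPlus {d : ℕ} (s : ℝ) (aa : EucSp d → ℝ) (φ : EucSp d → EReal)
    (F : Config d → ℝ) (γ : Config d) : ℝ :=
  -(∑' x : γ.1, ∫ y : EucSp d,
      aa (x.1 - y) * rexp ((s : EReal) * energy φ x.1 (γ.1 \ {x.1}) +
        ((s - 1 : ℝ) : EReal) * energy φ y (γ.1 \ {x.1})) * Dplus F y (γ.del x.1))

/-- `H_0^-` (death part of the Glauber generator). -/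
def H0Minus {d : ℕ} (s : ℝ) (φ : EucSp d → EReal) (F : Config d → ℝ) (γ : Config d) : ℝ :=
  -(∑' x : γ.1, rexp ((s : EReal) * energy φ x.1 (γ.1 \ {x.1})) * Dminus F x.1 γ)

/-- `H_0^+` (birth part of the Glauber generator). -/
def H0Plus {d : ℕ} (s z : ℝ) (φ : EucSp d → EReal) (F : Config d → ℝ) (γ : Config d) : ℝ :=
  -∫ x : EucSp d, z * rexp (((s - 1 : ℝ) : EReal) * energy φ x γ.1) * Dplus F x γ

/-- The standing assumptions of the paper: `s ∈ [0,1/2]`, a stable pair potential in the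
low activity–high temperature regime, bounded outside a ball, and `μ` the Gibbs measure
from Ruelle's theorem with its correlation and Ursell functions. -/
structure Setting (d : ℕ) (s z B ξ : ℝ) (φ : EucSp d → EReal) (μ : Measure (Config d))
    (k u : ∀ n : ℕ, (Fin n → EucSp d) → ℝ) : Prop where
  hd : 0 < d
  hs0 : 0 ≤ s
  hs1 : s ≤ 1 / 2
  pp : IsPairPotential φ
  hB : 0 ≤ B
  stable : Stable φ B
  hz : 0 < z
  laht : LAHT φ z B
  bddOutside : ∃ R C : ℝ, ∀ x : EucSp d, R ≤ ‖x‖ → ∃ r : ℝ, φ x = (r : EReal) ∧ |r| ≤ C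
  prob : IsProbabilityMeasure μ
  gnz : GNZ z φ μ
  corr : HasCorrFns μ k
  ti : TransInvFns k
  hξ : 0 < ξ
  ruelle : RuelleBound k ξ
  ursell : IsUrsell k u
  ursellInt : ∀ m : ℕ,
    Integrable (fun y : Fin (m + 1) → EucSp d => u (m + 2) (Fin.cons 0 y)) volume

/-- The jump kernel `a`: bounded, nonnegative, even, integrable. -/
structure GoodA {d : ℕ} (a : EucSp d → ℝ) : Prop where
  meas : Measurable a
  nonneg : ∀ x, 0 ≤ a x
  bdd : ∃ C, ∀ x, a x ≤ C
  even : ∀ x, a (-x) = a x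
  int : Integrable a volume

/-- `φ(x) → 0` as `|x| → ∞`. -/
def PhiVanishes {d : ℕ} (φ : EucSp d → EReal) : Prop :=
  Tendsto φ (cocompact (EucSp d)) (nhds (0 : EReal))

/-- The normalization `∫ a dx = (∫_Γ exp[(s-1) ∑_{u∈γ} φ(u)] dμ(γ))⁻¹`. -/
def NormalizedA {d : ℕ} (s : ℝ) (a : EucSp d → ℝ) (φ : EucSp d → EReal)
    (μ : Measure (Config d)) : Prop :=
  (∫ x : EucSp d, a x) = (∫ γ, rexp (((s - 1 : ℝ) : EReal) * totPhi φ γ.1) ∂μ)⁻¹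


/-! ### Measurable structure of the configuration space -/

theorem Config.measurable_encard_inter {d : ℕ} {B : Set (EucSp d)} (hB : MeasurableSet B) :
    Measurable fun γ : Config d => (γ.1 ∩ B).encard := by
  intro S _
  have h : MeasurableSpace.comap (fun γ : Config d => (γ.1 ∩ B).encard) (⊤ : MeasurableSpace ℕ∞)
      ≤ Config.instMS d := le_iSup₂_of_le B hB le_rfl
  exact h _ ⟨S, trivial, rfl⟩

theorem Config.measurable_of_encard {d : ℕ} {Ω : Type*} [MeasurableSpace Ω] {g : Ω → Config d}
    (h : ∀ B : Set (EucSp d), MeasurableSet B →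
      Measurable fun ω => (((g ω).1 ∩ B).encard : ℝ≥0∞)) : Measurable g := by
  have key : ∀ B : Set (EucSp d), MeasurableSet B →
      Measurable fun ω => ((g ω).1 ∩ B).encard := fun B hB => by
    refine measurable_to_countable' fun n => ?_
    have := h B hB (measurableSet_singleton (n : ℝ≥0∞))
    convert this using 1
    ext ω
    simp
  refine Measurable.of_comap_le ?_
  rw [Config.instMS, MeasurableSpace.comap_iSup]
  refine iSup_le fun B => ?_
  rw [MeasurableSpace.comap_iSup]
  refine iSup_le fun hB => ?_
  rw [MeasurableSpace.comap_comp]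
  exact (key B hB).comap_le

theorem Config.countable {d : ℕ} (γ : Config d) : γ.1.Countable := by
  have h : γ.1 = ⋃ n : ℕ, γ.1 ∩ Metric.closedBall 0 n := by
    rw [← inter_iUnion, Metric.iUnion_closedBall_nat, inter_univ]
  rw [h]
  exact countable_iUnion fun n => (γ.2 _ (isCompact_closedBall _ _)).countable

/-- The kernel sending a configuration `γ` to the point measure `∑_{x ∈ γ} δ_x`. -/
def pointKernel (d : ℕ) : ProbabilityTheory.Kernel (Config d) (EucSp d) where
  toFun γ := Measure.count.restrict γ.1
  measurable' := Measure.measurable_of_measurable_coe _ fun B hB => by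
    have h : (fun γ : Config d => (Measure.count.restrict γ.1 : Measure (EucSp d)) B)
        = fun γ => ((γ.1 ∩ B).encard : ℝ≥0∞) := by
      ext γ
      rw [Measure.restrict_apply hB, Measure.count_apply (hB.inter γ.countable.measurableSet),
        inter_comm]
    rw [h]
    exact (measurable_of_countable _).comp (Config.measurable_encard_inter hB)

theorem pointKernel_apply {d : ℕ} (γ : Config d) {B : Set (EucSp d)} (hB : MeasurableSet B) :
    pointKernel d γ B = ((γ.1 ∩ B).encard : ℝ≥0∞) := by
  change (Measure.count.restrict γ.1 : Measure (EucSp d)) B = _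
  rw [Measure.restrict_apply hB, Measure.count_apply (hB.inter γ.countable.measurableSet),
        inter_comm]

theorem lintegral_pointKernel {d : ℕ} (γ : Config d) (f : EucSp d → ℝ≥0∞) :
    ∫⁻ x, f x ∂(pointKernel d γ) = ∑' x : γ.1, f x.1 := by
  change ∫⁻ x in γ.1, f x ∂(Measure.count : Measure (EucSp d)) = _
  rw [lintegral_countable _ γ.countable]
  simp

instance (d : ℕ) : ProbabilityTheory.IsSFiniteKernel (pointKernel d) := by
  set A : ℕ → Set (EucSp d) := disjointed fun n : ℕ => Metric.closedBall 0 (n : ℝ) with hA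
  have hAm : ∀ n, MeasurableSet (A n) :=
    MeasurableSet.disjointed fun n => Metric.isClosed_closedBall.measurableSet
  have hAd : Pairwise (Function.onFun Disjoint A) := disjoint_disjointed _
  have hAu : ⋃ n, A n = univ := by
    rw [hA, iUnion_disjointed, Metric.iUnion_closedBall_nat]
  have hs : ∀ (n : ℕ) (k : ℕ), MeasurableSet {γ : Config d | (γ.1 ∩ A n).encard = k} :=
    fun n k => Config.measurable_encard_inter (hAm n) (measurableSet_singleton _)
  let K : ℕ × ℕ → ProbabilityTheory.Kernel (Config d) (EucSp d) := fun m =>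
    ProbabilityTheory.Kernel.piecewise (hs m.1 m.2) ((pointKernel d).restrict (hAm m.1)) 0
  have hfin : ∀ m, ProbabilityTheory.IsFiniteKernel (K m) := fun m => by
    refine ⟨(m.2 : ℝ≥0∞), by simp, fun γ => ?_⟩
    simp only [K, ProbabilityTheory.Kernel.piecewise_apply']
    split_ifs with h
    · rw [ProbabilityTheory.Kernel.restrict_apply' _ _ _ MeasurableSet.univ, univ_inter,
        pointKernel_apply _ (hAm _)]
      rw [mem_ofPred_eq] at h
      simp [h]
    · simp
  have hsum : pointKernel d = ProbabilityTheory.Kernel.sum K := by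
    ext γ B hB
    rw [ProbabilityTheory.Kernel.sum_apply' _ _ hB, ENNReal.tsum_prod']
    have h1 : ∀ n, ∑' k, K (n, k) γ B = pointKernel d γ (B ∩ A n) := fun n => by
      obtain ⟨k₀, hk₀⟩ : ∃ k : ℕ, (γ.1 ∩ A n).encard = k := by
        have : (γ.1 ∩ A n).Finite := (γ.2 _ (isCompact_closedBall 0 (n : ℝ))).subset
          (inter_subset_inter_right _ (disjointed_subset _ n))
        exact ⟨_, this.encard_eq_coe_toFinset_card⟩
      rw [tsum_eq_single k₀]
      · simp only [K, ProbabilityTheory.Kernel.piecewise_apply']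
        rw [if_pos (by simpa using hk₀), ProbabilityTheory.Kernel.restrict_apply' _ _ _ hB]
      · intro k hk
        simp only [K, ProbabilityTheory.Kernel.piecewise_apply']
        rw [if_neg]
        · simp
        · simp only [mem_ofPred_eq, hk₀]
          exact fun h => hk (by exact_mod_cast h.symm)
    simp_rw [h1]
    rw [← measure_iUnion (fun i j hij => (hAd hij).mono inter_subset_right inter_subset_right)
      fun n => hB.inter (hAm n), ← inter_iUnion, hAu, inter_univ]
  rw [hsum]
  infer_instance

theorem measurable_tsum_config {d : ℕ} {Ω : Type*} [MeasurableSpace Ω] {g : Ω → Config d}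
    (hg : Measurable g) {h : Ω → EucSp d → ℝ≥0∞} (hh : Measurable (Function.uncurry h)) :
    Measurable fun ω => ∑' x : (g ω).1, h ω x.1 := by
  have := hh.lintegral_kernel_prod_right (κ := (pointKernel d).comap g hg)
  simpa only [ProbabilityTheory.Kernel.comap_apply, lintegral_pointKernel] using this

theorem measurable_tsum_config_real {d : ℕ} {Ω : Type*} [MeasurableSpace Ω] {g : Ω → Config d}
    (hg : Measurable g) {h : Ω → EucSp d → ℝ} (hh : Measurable (Function.uncurry h)) :
    MeasurableSet {ω | Summable fun x : (g ω).1 => h ω x.1} ∧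
      Measurable fun ω => ∑' x : (g ω).1, h ω x.1 := by
  have hS : MeasurableSet {ω | Summable fun x : (g ω).1 => h ω x.1} := by
    have h1 : {ω | Summable fun x : (g ω).1 => h ω x.1}
        = {ω | ∑' x : (g ω).1, ‖h ω x.1‖ₑ ≠ ∞} := by
      ext ω
      simp only [mem_ofPred_eq]
      rw [← summable_norm_iff, ← tsum_enorm_ne_top_iff_summable_norm]
    rw [h1]
    exact (measurable_tsum_config hg (h := fun ω x => ‖h ω x‖ₑ) hh.enorm)
      (measurableSet_singleton _).compl
  refine ⟨hS, ?_⟩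
  have hpos := measurable_tsum_config hg (h := fun ω x => ENNReal.ofReal (h ω x)) hh.ennreal_ofReal
  have hneg := measurable_tsum_config hg (h := fun ω x => ENNReal.ofReal (-h ω x))
    hh.neg.ennreal_ofReal
  have heq : (fun ω => ∑' x : (g ω).1, h ω x.1) = fun ω =>
      if Summable fun x : (g ω).1 => h ω x.1 then
        (∑' x : (g ω).1, ENNReal.ofReal (h ω x.1)).toReal
          - (∑' x : (g ω).1, ENNReal.ofReal (-h ω x.1)).toReal
      else 0 := by
    ext ω
    split_ifs with hs
    · rw [ENNReal.tsum_toReal_eq (fun _ => ENNReal.ofReal_ne_top),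
        ENNReal.tsum_toReal_eq (fun _ => ENNReal.ofReal_ne_top)]
      simp only [ENNReal.toReal_ofReal']
      have hp : Summable fun x : (g ω).1 => max (h ω x.1) 0 :=
        hs.abs.of_nonneg_of_le (fun _ => le_max_right _ _)
          fun x => max_le (le_abs_self _) (abs_nonneg _)
      have hn : Summable fun x : (g ω).1 => max (-h ω x.1) 0 :=
        hs.abs.of_nonneg_of_le (fun _ => le_max_right _ _)
          fun x => max_le (neg_le_abs _) (abs_nonneg _)
      rw [← hp.tsum_sub hn]
      refine tsum_congr fun x => ?_
      rcases le_total (h ω x.1) 0 with h0 | h0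
      · rw [max_eq_right h0, max_eq_left (by linarith)]; ring
      · rw [max_eq_left h0, max_eq_right (by linarith)]; ring
    · exact tsum_eq_zero_of_not_summable hs
  rw [heq]
  exact Measurable.ite hS (hpos.ennreal_toReal.sub hneg.ennreal_toReal) measurable_const

theorem encard_eq_tsum_indicator {d : ℕ} (γ : Config d) (B : Set (EucSp d)) :
    ((γ.1 ∩ B).encard : ℝ≥0∞) = ∑' x : γ.1, B.indicator 1 x.1 := by
  rw [tsum_subtype γ.1 (B.indicator (1 : EucSp d → ℝ≥0∞)), indicator_indicator,
    ← tsum_subtype (γ.1 ∩ B) (1 : EucSp d → ℝ≥0∞)]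
  simp

theorem encard_ins_inter {d : ℕ} (γ : Config d) (x : EucSp d) (B : Set (EucSp d)) :
    (((γ.ins x).1 ∩ B).encard : ℝ≥0∞)
      = ∑' y : γ.1, (if y.1 ∈ B ∧ y.1 ≠ x then 1 else 0) + B.indicator 1 x := by
  have h1 : ∑' y : γ.1, (if y.1 ∈ B ∧ y.1 ≠ x then 1 else 0 : ℝ≥0∞)
      = (((γ.1 ∩ B) \ {x}).encard : ℝ≥0∞) := by
    have := encard_eq_tsum_indicator γ (B \ {x})
    rw [← inter_sdiff_assoc] at this
    rw [this]
    refine tsum_congr fun y => ?_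
    simp [indicator_apply]
  rw [h1]
  by_cases hx : x ∈ B
  · have : (γ.ins x).1 ∩ B = insert x ((γ.1 ∩ B) \ {x}) := by
      change insert x γ.1 ∩ B = _
      rw [insert_sdiff_singleton, insert_inter_of_mem hx]
    rw [this, encard_insert_of_notMem (by simp)]
    simp [hx]
  · have : (γ.ins x).1 ∩ B = (γ.1 ∩ B) \ {x} := by
      change insert x γ.1 ∩ B = _
      rw [insert_inter_of_notMem hx, sdiff_singleton_eq_self (by simp [hx])]
    rw [this]
    simp [hx]

theorem measurableSet_setOf_mem_and_ne {d : ℕ} {B : Set (EucSp d)} (hB : MeasurableSet B)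
    {Ω : Type*} [MeasurableSpace Ω] {f : Ω → EucSp d} (hf : Measurable f) :
    Measurable (Function.uncurry fun (ω : Ω) (y : EucSp d) =>
      (if y ∈ B ∧ y ≠ f ω then 1 else 0 : ℝ≥0∞)) := by
  refine Measurable.ite ?_ measurable_const measurable_const
  exact (measurable_snd hB).inter
    (measurableSet_eq_fun measurable_snd (hf.comp measurable_fst)).compl

theorem Config.measurable_ins {d : ℕ} {Ω : Type*} [MeasurableSpace Ω] {g : Ω → Config d}
    (hg : Measurable g) {f : Ω → EucSp d} (hf : Measurable f) :
    Measurable fun ω => (g ω).ins (f ω) := by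
  refine Config.measurable_of_encard fun B hB => ?_
  simp_rw [encard_ins_inter]
  exact (measurable_tsum_config hg (measurableSet_setOf_mem_and_ne hB hf)).add
    ((measurable_one.indicator hB).comp hf)

theorem Config.measurable_del {d : ℕ} {Ω : Type*} [MeasurableSpace Ω] {g : Ω → Config d}
    (hg : Measurable g) {f : Ω → EucSp d} (hf : Measurable f) :
    Measurable fun ω => (g ω).del (f ω) := by
  refine Config.measurable_of_encard fun B hB => ?_
  have h (ω : Ω) : ((((g ω).del (f ω)).1 ∩ B).encard : ℝ≥0∞)
      = ∑' y : (g ω).1, (if y.1 ∈ B ∧ y.1 ≠ f ω then 1 else 0) := by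
    have h1 : ((g ω).del (f ω)).1 ∩ B = (g ω).1 ∩ (B \ {f ω}) := by
      change ((g ω).1 \ {f ω}) ∩ B = _
      ext; simp; tauto
    rw [h1, encard_eq_tsum_indicator]
    refine tsum_congr fun y => ?_
    simp [indicator_apply]
  simp_rw [h]
  exact measurable_tsum_config hg (measurableSet_setOf_mem_and_ne hB hf)

theorem Cyl.measurable {d : ℕ} {F : Config d → ℝ} (hF : Cyl F) : Measurable F := by
  obtain ⟨N, f, g, hf, hg, -, hFg⟩ := hF
  rw [show F = fun γ => g fun i => cpair (f i) γ from funext hFg]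
  refine hg.measurable.comp (measurable_pi_lambda _ fun i => ?_)
  exact (measurable_tsum_config_real measurable_id (h := fun _ x => f i x)
    ((hf i).1.measurable.comp measurable_snd)).2

theorem measurable_energy {d : ℕ} {φ : EucSp d → EReal} (hφ : Measurable φ)
    {Ω : Type*} [MeasurableSpace Ω] {g : Ω → Config d}
    (hg : Measurable g) {f : Ω → EucSp d} (hf : Measurable f) :
    Measurable fun ω => energy φ (f ω) (g ω).1 := by
  have hφ' : Measurable (Function.uncurry fun (ω : Ω) (y : EucSp d) => φ (f ω - y)) :=
    hφ.comp ((hf.comp measurable_fst).sub measurable_snd)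
  obtain ⟨hS, hT⟩ := measurable_tsum_config_real hg
    (h := fun ω y => (φ (f ω - y)).toReal) hφ'.ereal_toReal
  refine Measurable.ite (MeasurableSet.inter
    (s₁ := {ω | ∀ y ∈ (g ω).1, φ (f ω - y) ≠ ⊤}) ?_ hS) hT.coe_real_ereal measurable_const
  have hI : Measurable (Function.uncurry fun (ω : Ω) (y : EucSp d) =>
      (if φ (f ω - y) = ⊤ then 1 else 0 : ℝ≥0∞)) :=
    Measurable.ite (hφ' (measurableSet_singleton _)) measurable_const measurable_const
  have h0 := measurable_tsum_config hg hI (measurableSet_singleton 0)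
  convert h0 using 1
  ext ω
  simp only [mem_ofPred_eq, mem_preimage, mem_singleton_iff, ENNReal.tsum_eq_zero, Subtype.forall,
    ite_eq_right_iff, one_ne_zero, imp_false]

/-! ### Integrals of products over a configuration -/

/-- An ordered `(n+1)`-tuple of distinct points of `γ` is a point `x` of `γ` followed by an ordered
`n`-tuple of distinct points of `γ ∖ {x}`. -/
def injTuplesSuccEquiv {d : ℕ} (n : ℕ) (γ : Set (EucSp d)) :
    (Σ x : γ, injTuples n (γ \ {x.1})) ≃ injTuples (n + 1) γ where
  toFun q := ⟨Fin.cons q.1.1 q.2.1, by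
    refine ⟨Fin.cons_injective_iff.2 ⟨?_, q.2.2.1⟩, ?_⟩
    · rintro ⟨i, hi⟩
      exact (q.2.2.2 i).2 hi
    · intro i
      refine Fin.cases q.1.2 (fun j => (q.2.2.2 j).1) i⟩
  invFun p := ⟨⟨p.1 0, p.2.2 0⟩, ⟨Fin.tail p.1, by
    refine ⟨fun i j h => Fin.succ_injective _ (p.2.1 h), fun i => ⟨p.2.2 _, fun h => ?_⟩⟩
    exact Fin.succ_ne_zero i (p.2.1 h)⟩⟩
  left_inv q := rfl
  right_inv p := Subtype.ext (Fin.cons_self_tail p.1)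

theorem tsum_injTuples_succ {d : ℕ} (n : ℕ) (γ : Set (EucSp d)) (G : EucSp d → ℝ≥0∞) :
    ∑' p : injTuples (n + 1) γ, ∏ i, G (p.1 i)
      = ∑' x : γ, G x.1 * ∑' q : injTuples n (γ \ {x.1}), ∏ i, G (q.1 i) := by
  rw [← (injTuplesSuccEquiv n γ).tsum_eq, ENNReal.tsum_sigma']
  refine tsum_congr fun x => ?_
  rw [← ENNReal.tsum_mul_left]
  refine tsum_congr fun q => ?_
  rw [Fin.prod_univ_succ]
  rfl

theorem tsum_injTuples_zero {d : ℕ} (γ : Set (EucSp d)) (G : EucSp d → ℝ≥0∞) :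
    ∑' p : injTuples 0 γ, ∏ i, G (p.1 i) = 1 := by
  have : Unique (injTuples 0 γ) :=
    { default := ⟨Fin.elim0, fun i => i.elim0, fun i => i.elim0⟩
      uniq := fun p => Subtype.ext (funext fun i => i.elim0) }
  rw [tsum_eq_single default (fun b hb => absurd (Unique.eq_default b) hb)]
  simp

theorem measurable_tsum_injTuples {d : ℕ} (n : ℕ) {G : EucSp d → ℝ≥0∞} (hG : Measurable G) :
    Measurable fun γ : Config d => ∑' p : injTuples n γ.1, ∏ i, G (p.1 i) := by
  induction n with
  | zero => simp_rw [tsum_injTuples_zero]; exact measurable_const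
  | succ n ih =>
    simp_rw [tsum_injTuples_succ]
    refine measurable_tsum_config measurable_id
      (h := fun (γ : Config d) x => G x * ∑' q : injTuples n (γ.del x).1, ∏ i, G (q.1 i)) ?_
    exact (hG.comp measurable_snd).mul
      (ih.comp (Config.measurable_del measurable_fst measurable_snd))

theorem factorial_mul_sum_powersetCard_le {d : ℕ} (n : ℕ) {γ : Set (EucSp d)}
    (η : Finset (EucSp d)) (hη : (η : Set (EucSp d)) ⊆ γ) (G : EucSp d → ℝ≥0∞) :
    (n.factorial : ℝ≥0∞) * ∑ T ∈ η.powersetCard n, ∏ y ∈ T, G y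
      ≤ ∑' p : injTuples n γ, ∏ i, G (p.1 i) := by
  let ι : (Σ T : η.powersetCard n, (Fin n ≃ T.1)) → injTuples n γ := fun q =>
    ⟨fun i => (q.2 i).1, fun i j h => q.2.injective (Subtype.ext h),
      fun i => hη ((Finset.mem_powersetCard.1 q.1.2).1 (q.2 i).2)⟩
  have hι : Function.Injective ι := by
    rintro ⟨⟨T, hT⟩, e⟩ ⟨⟨T', hT'⟩, e'⟩ h
    have hfun : ∀ i, (e i).1 = (e' i).1 := fun i => congrFun (congrArg Subtype.val h) i
    have hTT : T = T' := by
      ext y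
      constructor
      · intro hy
        have := hfun (e.symm ⟨y, hy⟩)
        rw [Equiv.apply_symm_apply] at this
        rw [show y = _ from this]
        exact (e' _).2
      · intro hy
        have := hfun (e'.symm ⟨y, hy⟩)
        rw [Equiv.apply_symm_apply] at this
        rw [show y = _ from this.symm]
        exact (e _).2
    subst hTT
    have : e = e' := Equiv.ext fun i => Subtype.ext (hfun i)
    rw [this]
  calc (n.factorial : ℝ≥0∞) * ∑ T ∈ η.powersetCard n, ∏ y ∈ T, G y
      = ∑' q : (Σ T : η.powersetCard n, (Fin n ≃ T.1)), ∏ i, G ((ι q).1 i) := by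
        rw [ENNReal.tsum_sigma', tsum_fintype, Finset.mul_sum, ← Finset.sum_coe_sort]
        refine Finset.sum_congr rfl fun T _ => ?_
        have h1 : ∀ e : Fin n ≃ T.1, ∏ i, G ((ι ⟨T, e⟩).1 i) = ∏ y ∈ T.1, G y := fun e => by
          rw [← Finset.prod_coe_sort T.1 G]
          exact Equiv.prod_comp e fun y : T.1 => G y
        have hc : Fintype.card (Fin n) = Fintype.card T.1 := by
          rw [Fintype.card_fin, Fintype.card_coe, (Finset.mem_powersetCard.1 T.2).2]
        rw [tsum_fintype, Finset.sum_congr rfl fun e _ => h1 e, Finset.sum_const, Finset.card_univ,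
          Fintype.card_equiv (Fintype.equivOfCardEq hc), Fintype.card_fin, nsmul_eq_mul]
    _ ≤ _ := ENNReal.tsum_comp_le_tsum_of_injective hι fun p => ∏ i, G (p.1 i)

theorem prod_one_add_le_tsum_injTuples {d : ℕ} {γ : Set (EucSp d)}
    (η : Finset (EucSp d)) (hη : (η : Set (EucSp d)) ⊆ γ) (G : EucSp d → ℝ≥0∞) :
    ∏ y ∈ η, (1 + G y)
      ≤ ∑' n : ℕ, (n.factorial : ℝ≥0∞)⁻¹ * ∑' p : injTuples n γ, ∏ i, G (p.1 i) := by
  rw [Finset.prod_one_add, Finset.sum_powerset]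
  refine (Finset.sum_le_sum fun n _ => ?_).trans (ENNReal.sum_le_tsum (Finset.range (η.card + 1)))
  rw [← ENNReal.mul_le_iff_le_inv (by exact_mod_cast n.factorial_ne_zero)
    (ENNReal.natCast_ne_top _)]
  exact factorial_mul_sum_powersetCard_le n η hη G

theorem lintegral_fin_prod_eq_pow {E : Type*} [MeasureSpace E] [SigmaFinite (volume : Measure E)]
    (n : ℕ) {G : E → ℝ≥0∞} (hG : Measurable G) :
    ∫⁻ x : Fin n → E, ∏ i, G (x i) = (∫⁻ y, G y) ^ n := by
  induction n with
  | zero => simp [volume_pi]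
  | succ n ih =>
    rw [← ((volume_preserving_piFinSuccAbove (fun _ : Fin (n + 1) => E) 0).symm).lintegral_comp
      (by fun_prop)]
    simp_rw [MeasurableEquiv.piFinSuccAbove_symm_apply, Fin.insertNthEquiv,
      Fin.prod_univ_succ, Fin.insertNth_zero, Equiv.coe_fn_mk, Fin.cons_succ, Fin.cons_zero]
    rw [Measure.volume_eq_prod]
    have := lintegral_prod_mul (μ := (volume : Measure E)) (ν := (volume : Measure (Fin n → E)))
      hG.aemeasurable (g := fun x => ∏ i, G (x i))
      (Measurable.aemeasurable (by fun_prop))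
    rw [ih, ← pow_succ'] at this
    exact this

theorem lintegral_tsum_injTuples_le {d : ℕ} {μ : Measure (Config d)} [IsProbabilityMeasure μ]
    {k : ∀ n : ℕ, (Fin n → EucSp d) → ℝ} (hk : HasCorrFns μ k) {ξ : ℝ}
    (hξ : 0 ≤ ξ) (hR : RuelleBound k ξ) (n : ℕ) {G : EucSp d → ℝ≥0∞} (hG : Measurable G) :
    ∫⁻ γ, ∑' p : injTuples n γ.1, ∏ i, G (p.1 i) ∂μ
      ≤ (ENNReal.ofReal ξ * ∫⁻ y, G y) ^ n := by
  rcases Nat.eq_zero_or_pos n with rfl | hn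
  · simp_rw [tsum_injTuples_zero]
    simp
  · rw [hk.2 n hn (fun x => ∏ i, G (x i)) (by fun_prop)
      (fun σ x => Equiv.prod_comp σ fun i => G (x i)), mul_pow,
      ← lintegral_fin_prod_eq_pow n hG, ← lintegral_const_mul _ (by fun_prop)]
    refine lintegral_mono fun x => ?_
    rw [mul_comm]
    gcongr
    rw [← ENNReal.ofReal_pow hξ]
    exact ENNReal.ofReal_le_ofReal (hR n hn x)

theorem tsum_pow_div_factorial_ne_top {c : ℝ≥0∞} (hc : c ≠ ∞) :
    ∑' n : ℕ, (n.factorial : ℝ≥0∞)⁻¹ * c ^ n ≠ ∞ := by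
  have h (n : ℕ) : (n.factorial : ℝ≥0∞)⁻¹ * c ^ n
      = ENNReal.ofReal (c.toReal ^ n / n.factorial) := by
    rw [ENNReal.ofReal_div_of_pos (by exact_mod_cast n.factorial_pos),
      ENNReal.ofReal_pow ENNReal.toReal_nonneg, ENNReal.ofReal_toReal hc, ENNReal.ofReal_natCast,
      mul_comm, div_eq_mul_inv]
  simp_rw [h]
  exact (Real.summable_pow_div_factorial _).tsum_ofReal_ne_top

/-! ### Exponential moments of the relative energy -/

theorem eexp_coe (r : ℝ) : eexp (r : EReal) = ENNReal.ofReal (Real.exp r) := by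
  simp [eexp]

theorem eexp_bot : eexp ⊥ = 0 := by simp [eexp]

theorem measurable_eexp : Measurable eexp :=
  Measurable.ite (measurableSet_singleton _) measurable_const
    (Measurable.ite (measurableSet_singleton _) measurable_const
      (Real.measurable_exp.comp measurable_id.ereal_toReal).ennreal_ofReal)

theorem measurable_rexp : Measurable rexp := measurable_eexp.ennreal_toReal

theorem energy_eq_top_or_coe {d : ℕ} (φ : EucSp d → EReal) (x : EucSp d) (γ : Set (EucSp d)) :
    energy φ x γ = ⊤ ∨ ∃ r : ℝ, energy φ x γ = r := by
  unfold energy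
  split_ifs
  · exact Or.inr ⟨_, rfl⟩
  · exact Or.inl rfl

/-- The Mayer-type function `(e^{-pφ} - 1)⁺`. -/
def mayerPos {d : ℕ} (p : ℝ) (φ : EucSp d → EReal) (v : EucSp d) : ℝ≥0∞ :=
  ENNReal.ofReal (Real.exp (-p * (φ v).toReal) - 1)

theorem measurable_mayerPos {d : ℕ} (p : ℝ) {φ : EucSp d → EReal} (hφ : Measurable φ) :
    Measurable (mayerPos p φ) :=
  ((Real.measurable_exp.comp (hφ.ereal_toReal.const_mul (-p))).sub_const 1).ennreal_ofReal

theorem eexp_energy_le_tsum {d : ℕ} {p : ℝ} (hp : 0 < p) (φ : EucSp d → EReal) (x : EucSp d)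
    (γ : Set (EucSp d)) :
    eexp (((-p : ℝ) : EReal) * energy φ x γ) ≤ ∑' n : ℕ, (n.factorial : ℝ≥0∞)⁻¹ *
      ∑' q : injTuples n γ, ∏ i, mayerPos p φ (x - q.1 i) := by
  unfold energy
  split_ifs with h
  · rw [← EReal.coe_mul, eexp_coe]
    have h1 : Tendsto (fun t : Finset γ =>
        ENNReal.ofReal (Real.exp (-p * ∑ y ∈ t, (φ (x - y.1)).toReal))) atTop
        (𝓝 (ENNReal.ofReal (Real.exp (-p * ∑' y : γ, (φ (x - y.1)).toReal)))) :=
      (ENNReal.continuous_ofReal.tendsto _).comp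
        ((Real.continuous_exp.tendsto _).comp (h.2.hasSum.const_mul (-p)))
    refine le_of_tendsto' h1 fun t => ?_
    refine le_trans ?_ (prod_one_add_le_tsum_injTuples (t.map (Function.Embedding.subtype _))
      (by simp) fun y => mayerPos p φ (x - y))
    rw [Finset.prod_map, Finset.mul_sum, Real.exp_sum, ENNReal.ofReal_prod_of_nonneg
      fun _ _ => (Real.exp_pos _).le]
    refine Finset.prod_le_prod' fun y _ => ?_
    rw [mayerPos, ← ENNReal.ofReal_one]
    refine le_trans (le_of_eq ?_) ENNReal.ofReal_add_le
    simp
  · rw [EReal.coe_mul_top_of_neg (by linarith), eexp_bot]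
    exact zero_le

theorem IsPairPotential.lower_bound {d : ℕ} {φ : EucSp d → EReal} (hφ : IsPairPotential φ)
    {B : ℝ} (hS : Stable φ B) {v : EucSp d} (hv : v ≠ 0) :
    ∃ r : ℝ, φ v = r ∧ -(2 * B) ≤ r := by
  obtain ⟨r, hr⟩ : ∃ r : ℝ, φ v = r :=
    ⟨(φ v).toReal, (EReal.coe_toReal (hφ.finite_off v hv) (hφ.ne_bot v)).symm⟩
  refine ⟨r, hr, ?_⟩
  have h := hS {0, v}
  have h2 : ({0, v} : Finset (EucSp d)).offDiag = {(0, v), (v, 0)} := by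
    ext ⟨a, b⟩
    simp only [Finset.mem_offDiag, Finset.mem_insert, Finset.mem_singleton, Prod.mk.injEq]
    constructor
    · rintro ⟨rfl | rfl, rfl | rfl, h⟩ <;> simp_all
    · rintro (⟨rfl, rfl⟩ | ⟨rfl, rfl⟩) <;> simp [hv, hv.symm]
  rw [h2, Finset.sum_pair (by simp [hv]), Finset.card_pair hv.symm] at h
  simp only [zero_sub, sub_zero, hφ.even v hv, hr] at h
  rw [← EReal.coe_add, EReal.coe_le_coe_iff] at h
  push_cast at h
  linarith

theorem exp_neg_mul_sub_one_le {p r B : ℝ} (hp0 : 0 ≤ p) (hp2 : p ≤ 2) (hr : -(2 * B) ≤ r) :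
    Real.exp (-p * r) - 1 ≤ (Real.exp (2 * B) + 1) * |Real.exp (-r) - 1| := by
  have hE := Real.exp_pos (2 * B)
  rcases le_total 0 r with h | h
  · have : Real.exp (-p * r) ≤ 1 := Real.exp_le_one_iff.2 (by nlinarith)
    have h2 : 0 ≤ (Real.exp (2 * B) + 1) * |Real.exp (-r) - 1| := by positivity
    linarith
  · have h1 : Real.exp (-p * r) ≤ Real.exp (-r) * Real.exp (-r) := by
      rw [← Real.exp_add]
      exact Real.exp_le_exp.2 (by nlinarith)
    have h2 : 1 ≤ Real.exp (-r) := Real.one_le_exp (by linarith)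
    have h3 : Real.exp (-r) ≤ Real.exp (2 * B) := Real.exp_le_exp.2 (by linarith)
    rw [abs_of_nonneg (by linarith)]
    nlinarith

theorem lintegral_mayerPos_ne_top {d : ℕ} (hd : 0 < d) {φ : EucSp d → EReal}
    (hφ : IsPairPotential φ) {B z p : ℝ} (hS : Stable φ B) (hz : 0 < z) (hL : LAHT φ z B)
    (hp0 : 0 ≤ p) (hp2 : p ≤ 2) :
    ∫⁻ v, mayerPos p φ v ≠ ∞ := by
  have : Nonempty (Fin d) := ⟨⟨0, hd⟩⟩
  set c : ℝ≥0∞ := ENNReal.ofReal ((Real.exp (2 * B) + 1) / z)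
  have hle : ∫⁻ v, mayerPos p φ v
      ≤ ∫⁻ v, c * ENNReal.ofReal (|rexp (-(φ v)) - 1| * z) := by
    refine lintegral_mono_ae ?_
    filter_upwards [compl_mem_ae_iff.2 (measure_singleton (0 : EucSp d))] with v hv
    obtain ⟨r, hr, hrB⟩ := hφ.lower_bound hS (v := v) (by simpa using hv)
    rw [mayerPos, hr, ← EReal.coe_neg, rexp, eexp_coe, ENNReal.toReal_ofReal (Real.exp_pos _).le,
      EReal.toReal_coe, ← ENNReal.ofReal_mul (by positivity)]
    refine ENNReal.ofReal_le_ofReal ((exp_neg_mul_sub_one_le hp0 hp2 hrB).trans (le_of_eq ?_))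
    field_simp
  refine ne_top_of_le_ne_top ?_ hle
  rw [lintegral_const_mul' _ _ ENNReal.ofReal_ne_top]
  exact ENNReal.mul_ne_top ENNReal.ofReal_ne_top (hL.trans ENNReal.ofReal_lt_top).ne

theorem exists_lintegral_eexp_energy_le {d : ℕ} {s z B ξ : ℝ} {φ : EucSp d → EReal}
    {μ : Measure (Config d)} {k u : ∀ n : ℕ, (Fin n → EucSp d) → ℝ}
    (hset : Setting d s z B ξ φ μ k u) {p : ℝ} (hp0 : 0 < p) (hp2 : p ≤ 2) :
    ∃ K : ℝ≥0∞, K ≠ ∞ ∧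
      ∀ x, ∫⁻ γ, eexp (((-p : ℝ) : EReal) * energy φ x γ.1) ∂μ ≤ K := by
  have := hset.prob
  have hm := measurable_mayerPos p hset.pp.meas
  have hfin := lintegral_mayerPos_ne_top hset.hd hset.pp hset.stable hset.hz hset.laht hp0.le hp2
  refine ⟨_, tsum_pow_div_factorial_ne_top
    (ENNReal.mul_ne_top (ENNReal.ofReal_ne_top (r := ξ)) hfin), fun x => ?_⟩
  have hmx : Measurable fun y => mayerPos p φ (x - y) := hm.comp (measurable_const.sub measurable_id)
  calc ∫⁻ γ, eexp (((-p : ℝ) : EReal) * energy φ x γ.1) ∂μ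
      ≤ ∫⁻ γ, ∑' n : ℕ, (n.factorial : ℝ≥0∞)⁻¹ *
          ∑' q : injTuples n γ.1, ∏ i, mayerPos p φ (x - q.1 i) ∂μ :=
        lintegral_mono fun γ => eexp_energy_le_tsum hp0 φ x γ.1
    _ = ∑' n : ℕ, (n.factorial : ℝ≥0∞)⁻¹ *
          ∫⁻ γ, ∑' q : injTuples n γ.1, ∏ i, mayerPos p φ (x - q.1 i) ∂μ := by
        rw [lintegral_tsum fun n => ((measurable_tsum_injTuples n hmx).const_mul _).aemeasurable]
        exact tsum_congr fun n => lintegral_const_mul _ (measurable_tsum_injTuples n hmx)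
    _ ≤ _ := by
        refine ENNReal.tsum_le_tsum fun n => mul_le_mul_right ?_ _
        refine (lintegral_tsum_injTuples_le hset.corr hset.hξ.le hset.ruelle n hmx).trans ?_
        rw [lintegral_sub_left_eq_self (mayerPos p φ) x]

/-! ### The Kawasaki form as an integral over `Γ × ℝ^d × ℝ^d` -/

theorem Config.del_ins {d : ℕ} {γ : Config d} {x : EucSp d} (hx : x ∉ γ.1) :
    (γ.ins x).del x = γ :=
  Subtype.ext (insert_sdiff_self_of_notMem hx)

theorem Config.ae_notMem {d : ℕ} (hd : 0 < d) (γ : Config d) : ∀ᵐ x : EucSp d, x ∉ γ.1 := by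
  have : Nonempty (Fin d) := ⟨⟨0, hd⟩⟩
  exact compl_mem_ae_iff.2 (γ.countable.measure_zero _)

/-- The weight `exp[(s-1)E(x,γ)]`. -/
def gibbsWeight {d : ℕ} (s : ℝ) (φ : EucSp d → EReal) (γ : Config d) (x : EucSp d) : ℝ≥0∞ :=
  eexp (((s - 1 : ℝ) : EReal) * energy φ x γ.1)

theorem measurable_gibbsWeight {d : ℕ} (s : ℝ) {φ : EucSp d → EReal} (hφ : Measurable φ)
    {Ω : Type*} [MeasurableSpace Ω] {g : Ω → Config d} (hg : Measurable g)
    {f : Ω → EucSp d} (hf : Measurable f) :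
    Measurable fun ω => gibbsWeight s φ (g ω) (f ω) :=
  measurable_eexp.comp ((measurable_energy hφ hg hf).const_mul _)

theorem gibbsWeight_ne_top {d : ℕ} {s : ℝ} (hs : s < 1) (φ : EucSp d → EReal) (γ : Config d)
    (x : EucSp d) : gibbsWeight s φ γ x ≠ ∞ := by
  unfold gibbsWeight
  rcases energy_eq_top_or_coe φ x γ.1 with h | ⟨r, h⟩ <;> rw [h]
  · rw [EReal.coe_mul_top_of_neg (by linarith), eexp_bot]
    exact ENNReal.zero_ne_top
  · rw [← EReal.coe_mul, eexp_coe]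
    exact ENNReal.ofReal_ne_top

theorem gibbsWeight_mul_self {d : ℕ} {s : ℝ} (hs : s < 1) (φ : EucSp d → EReal) (γ : Config d)
    (x : EucSp d) : gibbsWeight s φ γ x * gibbsWeight s φ γ x
      = eexp (((-(2 * (1 - s)) : ℝ) : EReal) * energy φ x γ.1) := by
  unfold gibbsWeight
  rcases energy_eq_top_or_coe φ x γ.1 with h | ⟨r, h⟩ <;> rw [h]
  · rw [EReal.coe_mul_top_of_neg (by linarith), EReal.coe_mul_top_of_neg (by linarith), eexp_bot,
      zero_mul]
  · rw [← EReal.coe_mul, ← EReal.coe_mul, eexp_coe, eexp_coe,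
      ← ENNReal.ofReal_mul (Real.exp_pos _).le, ← Real.exp_add]
    ring_nf

theorem gibbsWeight_eq_zero_of_eexp_neg {d : ℕ} {s : ℝ} (hs : s < 1) {φ : EucSp d → EReal}
    {γ : Config d} {x : EucSp d} (h : eexp (-(energy φ x γ.1)) = 0) : gibbsWeight s φ γ x = 0 := by
  unfold gibbsWeight
  rcases energy_eq_top_or_coe φ x γ.1 with h' | ⟨r, h'⟩ <;> rw [h'] at h ⊢
  · rw [EReal.coe_mul_top_of_neg (by linarith), eexp_bot]
  · rw [← EReal.coe_neg, eexp_coe, ENNReal.ofReal_eq_zero] at h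
    exact absurd h (not_le.2 (Real.exp_pos _))

theorem eexp_neg_mul_ofReal_rexp {d : ℕ} {s : ℝ} (hs : s < 1) (φ : EucSp d → EReal)
    (γ : Config d) (x y : EucSp d) :
    eexp (-(energy φ x γ.1)) * ENNReal.ofReal (rexp ((s : EReal) * energy φ x γ.1 +
        ((s - 1 : ℝ) : EReal) * energy φ y γ.1))
      = gibbsWeight s φ γ x * gibbsWeight s φ γ y := by
  unfold gibbsWeight
  rcases energy_eq_top_or_coe φ x γ.1 with hx | ⟨r, hx⟩ <;> rw [hx]
  · rw [EReal.coe_mul_top_of_neg (x := s - 1) (by linarith), EReal.neg_top, eexp_bot, zero_mul,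
      zero_mul]
  · rcases energy_eq_top_or_coe φ y γ.1 with hy | ⟨t, hy⟩ <;> rw [hy]
    · rw [EReal.coe_mul_top_of_neg (x := s - 1) (by linarith), EReal.add_bot, eexp_bot, mul_zero,
        rexp, eexp_bot]
      simp
    · simp only [← EReal.coe_mul, ← EReal.coe_add, ← EReal.coe_neg, rexp, eexp_coe]
      rw [ENNReal.toReal_ofReal (Real.exp_pos _).le, ← ENNReal.ofReal_mul (Real.exp_pos _).le,
        ← ENNReal.ofReal_mul (Real.exp_pos _).le, ← Real.exp_add, ← Real.exp_add]
      ring_nf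

/-- The density of the Kawasaki jump measure after removing the jumping particle. -/
def jumpWeight {d : ℕ} (s z : ℝ) (a : EucSp d → ℝ) (φ : EucSp d → EReal)
    (q : Config d × EucSp d × EucSp d) : ℝ≥0∞ :=
  ENNReal.ofReal z * (ENNReal.ofReal (a (q.2.1 - q.2.2)) *
    (gibbsWeight s φ q.1 q.2.1 * gibbsWeight s φ q.1 q.2.2))

/-- The increment `F(γ ∪ y) - F(γ ∪ x)`. -/
def jumpDiff {d : ℕ} (F : Config d → ℝ) (q : Config d × EucSp d × EucSp d) : ℝ :=
  F (q.1.ins q.2.2) - F (q.1.ins q.2.1)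

/-- Twice the Kawasaki energy of `F`, with values in `[0,∞]`. -/
def jumpEnergy {d : ℕ} (s z : ℝ) (a : EucSp d → ℝ) (φ : EucSp d → EReal)
    (μ : Measure (Config d)) (F : Config d → ℝ) : ℝ≥0∞ :=
  ∫⁻ q, jumpWeight s z a φ q * ENNReal.ofReal (jumpDiff F q ^ 2)
    ∂(μ.prod (volume.prod volume))

theorem measurable_jumpWeight {d : ℕ} (s z : ℝ) {a : EucSp d → ℝ} (ha : Measurable a)
    {φ : EucSp d → EReal} (hφ : Measurable φ) : Measurable (jumpWeight s z a φ) := by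
  refine Measurable.const_mul (Measurable.mul ?_ (Measurable.mul ?_ ?_)) _
  · exact (ha.comp ((measurable_fst.comp measurable_snd).sub
      (measurable_snd.comp measurable_snd))).ennreal_ofReal
  · exact measurable_gibbsWeight s hφ measurable_fst (measurable_fst.comp measurable_snd)
  · exact measurable_gibbsWeight s hφ measurable_fst (measurable_snd.comp measurable_snd)

theorem measurable_jumpDiff {d : ℕ} {F : Config d → ℝ} (hF : Measurable F) :
    Measurable (jumpDiff F) :=
  (hF.comp (Config.measurable_ins measurable_fst (measurable_snd.comp measurable_snd))).sub
    (hF.comp (Config.measurable_ins measurable_fst (measurable_fst.comp measurable_snd)))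

theorem jumpWeight_ne_top {d : ℕ} {s : ℝ} (hs : s < 1) (z : ℝ) (a : EucSp d → ℝ)
    (φ : EucSp d → EReal) (q : Config d × EucSp d × EucSp d) : jumpWeight s z a φ q ≠ ∞ :=
  ENNReal.mul_ne_top ENNReal.ofReal_ne_top (ENNReal.mul_ne_top ENNReal.ofReal_ne_top
    (ENNReal.mul_ne_top (gibbsWeight_ne_top hs _ _ _) (gibbsWeight_ne_top hs _ _ _)))

/-- The integrand of the Kawasaki form. -/
def kawasakiIntegrand {d : ℕ} (s : ℝ) (a : EucSp d → ℝ) (φ : EucSp d → EReal) (F : Config d → ℝ)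
    (γ : Config d) (x y : EucSp d) : ℝ :=
  a (x - y) * rexp ((s : EReal) * energy φ x (γ.1 \ {x}) +
    ((s - 1 : ℝ) : EReal) * energy φ y (γ.1 \ {x})) * Dpm F x y γ * Dpm F x y γ

theorem kawasakiIntegrand_nonneg {d : ℕ} (s : ℝ) {a : EucSp d → ℝ} (ha : ∀ x, 0 ≤ a x)
    (φ : EucSp d → EReal) (F : Config d → ℝ) (γ : Config d) (x y : EucSp d) :
    0 ≤ kawasakiIntegrand s a φ F γ x y := by
  unfold kawasakiIntegrand
  rw [mul_assoc]
  exact mul_nonneg (mul_nonneg (ha _) ENNReal.toReal_nonneg) (mul_self_nonneg _)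

theorem measurable_kawasakiIntegrand {d : ℕ} (s : ℝ) {a : EucSp d → ℝ} (ha : Measurable a)
    {φ : EucSp d → EReal} (hφ : Measurable φ) {F : Config d → ℝ} (hF : Measurable F) :
    Measurable fun q : (Config d × EucSp d) × EucSp d =>
      kawasakiIntegrand s a φ F q.1.1 q.1.2 q.2 := by
  have hγ : Measurable fun q : (Config d × EucSp d) × EucSp d => q.1.1 :=
    measurable_fst.comp measurable_fst
  have hx : Measurable fun q : (Config d × EucSp d) × EucSp d => q.1.2 :=
    measurable_snd.comp measurable_fst
  have hdel := Config.measurable_del hγ hx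
  have hD : Measurable fun q : (Config d × EucSp d) × EucSp d => Dpm F q.1.2 q.2 q.1.1 :=
    (hF.comp (Config.measurable_ins hdel measurable_snd)).sub (hF.comp hγ)
  refine ((Measurable.mul (ha.comp (hx.sub measurable_snd)) ?_).mul hD).mul hD
  exact measurable_rexp.comp (((measurable_energy hφ hdel hx).const_mul _).add
    ((measurable_energy hφ hdel measurable_snd).const_mul _))

theorem measurable_kawasakiIntegrand_right {d : ℕ} (s : ℝ) {a : EucSp d → ℝ} (ha : Measurable a)
    {φ : EucSp d → EReal} (hφ : Measurable φ) {F : Config d → ℝ} (hF : Measurable F)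
    (γ : Config d) (x : EucSp d) : Measurable (kawasakiIntegrand s a φ F γ x) := by
  have h : Measurable fun y : EucSp d => (((γ, x), y) : (Config d × EucSp d) × EucSp d) :=
    measurable_prodMk_left
  exact (measurable_kawasakiIntegrand s ha hφ hF).comp h

theorem gnz_mul_kawasakiIntegrand {d : ℕ} {s : ℝ} (hs : s < 1) (z : ℝ) {a : EucSp d → ℝ}
    (ha0 : ∀ x, 0 ≤ a x) (φ : EucSp d → EReal) (F : Config d → ℝ) {γ : Config d} {x : EucSp d}
    (hx : x ∉ γ.1) (y : EucSp d) :
    ENNReal.ofReal z * eexp (-(energy φ x γ.1)) *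
        ENNReal.ofReal (kawasakiIntegrand s a φ F (γ.ins x) x y)
      = jumpWeight s z a φ (γ, x, y) * ENNReal.ofReal (jumpDiff F (γ, x, y) ^ 2) := by
  have hdel := Config.del_ins hx
  have hK : kawasakiIntegrand s a φ F (γ.ins x) x y
      = a (x - y) * rexp ((s : EReal) * energy φ x γ.1 + ((s - 1 : ℝ) : EReal) * energy φ y γ.1)
        * jumpDiff F (γ, x, y) ^ 2 := by
    have h2 : (γ.ins x).1 \ {x} = γ.1 := congrArg Subtype.val hdel
    unfold kawasakiIntegrand Dpm jumpDiff
    rw [hdel, h2, mul_assoc _ _ (_ - _), sq]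
  have hA := ENNReal.ofReal_mul (q := jumpDiff F (γ, x, y) ^ 2)
    (mul_nonneg (ha0 (x - y)) (ENNReal.toReal_nonneg (a := eexp ((s : EReal) * energy φ x γ.1 +
      ((s - 1 : ℝ) : EReal) * energy φ y γ.1))))
  rw [ENNReal.ofReal_mul (ha0 _)] at hA
  have hE := eexp_neg_mul_ofReal_rexp hs φ γ x y
  rw [rexp] at hE
  rw [hK, rexp, hA, jumpWeight, ← hE]
  simp only [mul_assoc, mul_left_comm]

theorem lintegral_kawasakiIntegrand {d : ℕ} (hd : 0 < d) {s z : ℝ} (hs : s < 1)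
    {a : EucSp d → ℝ} (ha : Measurable a) (ha0 : ∀ x, 0 ≤ a x) {φ : EucSp d → EReal}
    (hφ : Measurable φ) {μ : Measure (Config d)} [SFinite μ] (hG : GNZ z φ μ) {F : Config d → ℝ}
    (hF : Measurable F) :
    ∫⁻ γ, (∑' x : γ.1, ∫⁻ y, ENNReal.ofReal (kawasakiIntegrand s a φ F γ x.1 y)) ∂μ
      = jumpEnergy s z a φ μ F := by
  have hm := (measurable_kawasakiIntegrand s ha hφ hF).ennreal_ofReal
  have hmi : Measurable fun q : Config d × EucSp d =>
      ∫⁻ y, ENNReal.ofReal (kawasakiIntegrand s a φ F q.1 q.2 y) :=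
    hm.lintegral_prod_right' (ν := (volume : Measure (EucSp d)))
  refine (hG (fun γ x => ∫⁻ y, ENNReal.ofReal (kawasakiIntegrand s a φ F γ x y)) hmi).trans ?_
  have hq : Measurable fun q => jumpWeight s z a φ q * ENNReal.ofReal (jumpDiff F q ^ 2) :=
    (measurable_jumpWeight s z ha hφ).mul ((measurable_jumpDiff hF).pow_const 2).ennreal_ofReal
  rw [jumpEnergy, lintegral_prod _ hq.aemeasurable]
  refine lintegral_congr fun γ => ?_
  have hqγ : Measurable fun w : EucSp d × EucSp d =>
      jumpWeight s z a φ (γ, w) * ENNReal.ofReal (jumpDiff F (γ, w) ^ 2) :=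
    hq.comp measurable_prodMk_left
  rw [lintegral_prod _ hqγ.aemeasurable]
  refine lintegral_congr_ae ?_
  filter_upwards [Config.ae_notMem hd γ] with x hx
  have hmx : Measurable fun y => ENNReal.ofReal (kawasakiIntegrand s a φ F (γ.ins x) x y) :=
    (measurable_kawasakiIntegrand_right s ha hφ hF (γ.ins x) x).ennreal_ofReal
  rw [← lintegral_const_mul _ hmx]
  exact lintegral_congr fun y => gnz_mul_kawasakiIntegrand hs z ha0 φ F hx y

theorem kawasakiForm_eq {d : ℕ} (hd : 0 < d) {s z : ℝ} (hs : s < 1)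
    {a : EucSp d → ℝ} (ha : Measurable a) (ha0 : ∀ x, 0 ≤ a x) {φ : EucSp d → EReal}
    (hφ : Measurable φ) {μ : Measure (Config d)} [SFinite μ] (hG : GNZ z φ μ) {F : Config d → ℝ}
    (hF : Measurable F) (hfin : jumpEnergy s z a φ μ F ≠ ∞) :
    kawasakiForm s a φ μ F F = (1 / 2) * (jumpEnergy s z a φ μ F).toReal := by
  have hm := measurable_kawasakiIntegrand s ha hφ hF
  have hinner : ∀ γ x, ∫ y, kawasakiIntegrand s a φ F γ x y
      = (∫⁻ y, ENNReal.ofReal (kawasakiIntegrand s a φ F γ x y)).toReal := fun γ x =>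
    integral_eq_lintegral_of_nonneg_ae
      (ae_of_all _ fun y => kawasakiIntegrand_nonneg s ha0 φ F γ x y)
      (measurable_kawasakiIntegrand_right s ha hφ hF γ x).aestronglyMeasurable
  have hS : Measurable fun γ : Config d =>
      ∑' x : γ.1, ∫⁻ y, ENNReal.ofReal (kawasakiIntegrand s a φ F γ x.1 y) :=
    measurable_tsum_config measurable_id
      (h := fun γ x => ∫⁻ y, ENNReal.ofReal (kawasakiIntegrand s a φ F γ x y))
      hm.ennreal_ofReal.lintegral_prod_right'
  rw [← lintegral_kawasakiIntegrand hd hs ha ha0 hφ hG hF] at hfin ⊢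
  have hlt := ae_lt_top hS hfin
  rw [← integral_toReal hS.aemeasurable hlt]
  unfold kawasakiForm
  congr 1
  refine integral_congr_ae ?_
  filter_upwards [hlt] with γ hγ
  rw [ENNReal.tsum_toReal_eq fun x => ENNReal.ne_top_of_tsum_ne_top hγ.ne x]
  exact tsum_congr fun x => hinner γ x.1

/-! ### Bounded local functions -/

/-- Bounded measurable functions on `Γ` that depend only on the points in a compact set. -/
structure IsBddLocal {d : ℕ} (F : Config d → ℝ) : Prop where
  meas : Measurable F
  bdd : ∃ C, ∀ γ, |F γ| ≤ C
  local_ins : ∃ Λ : Set (EucSp d), IsCompact Λ ∧ ∀ (γ : Config d) (x : EucSp d),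
    x ∉ Λ → F (γ.ins x) = F γ

theorem IsBddLocal.sub {d : ℕ} {F G : Config d → ℝ} (hF : IsBddLocal F) (hG : IsBddLocal G) :
    IsBddLocal fun γ => F γ - G γ := by
  obtain ⟨C, hC⟩ := hF.bdd
  obtain ⟨D, hD⟩ := hG.bdd
  obtain ⟨Λ, hΛ, hFΛ⟩ := hF.local_ins
  obtain ⟨Δ, hΔ, hGΔ⟩ := hG.local_ins
  refine ⟨hF.meas.sub hG.meas, ⟨C + D, fun γ => (abs_sub _ _).trans (add_le_add (hC γ) (hD γ))⟩,
    Λ ∪ Δ, hΛ.union hΔ, fun γ x hx => ?_⟩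
  rw [mem_union, not_or] at hx
  rw [hFΛ γ x hx.1, hGΔ γ x hx.2]

theorem cpair_ins_of_eq_zero {d : ℕ} {f : EucSp d → ℝ} (γ : Config d) {x : EucSp d}
    (hx : f x = 0) : cpair f (γ.ins x) = cpair f γ := by
  have h (η : Config d) : cpair f η = ∑' y, η.1.indicator f y := tsum_subtype η.1 f
  rw [h, h]
  refine tsum_congr fun y => ?_
  by_cases hy : y = x
  · subst hy
    rw [indicator_apply_eq_zero.2 fun _ => hx, indicator_apply_eq_zero.2 fun _ => hx]
  · have hiff : y ∈ (γ.ins x).1 ↔ y ∈ γ.1 := by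
      change y ∈ insert x γ.1 ↔ _
      simp [hy]
    by_cases hm : y ∈ γ.1
    · rw [indicator_of_mem hm, indicator_of_mem (hiff.2 hm)]
    · rw [indicator_of_notMem hm, indicator_of_notMem (mt hiff.1 hm)]

theorem Cyl.isBddLocal {d : ℕ} {F : Config d → ℝ} (hF : Cyl F) : IsBddLocal F := by
  refine ⟨hF.measurable, ?_, ?_⟩ <;> obtain ⟨N, f, g, hf, -, ⟨C, hC⟩, hFg⟩ := hF
  · exact ⟨C, fun γ => hFg γ ▸ hC _⟩
  · refine ⟨⋃ i, tsupport (f i), isCompact_iUnion fun i => (hf i).2.isCompact, fun γ x hx => ?_⟩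
    rw [hFg, hFg]
    congr 1
    funext i
    exact cpair_ins_of_eq_zero γ (image_eq_zero_of_notMem_tsupport fun h => hx (mem_iUnion.2 ⟨i, h⟩))

theorem IsBddLocal.exists_jumpDiff_sq_le {d : ℕ} {F : Config d → ℝ} (hF : IsBddLocal F) :
    ∃ (c : ℝ≥0∞) (Λ : Set (EucSp d)), c ≠ ∞ ∧ IsCompact Λ ∧ ∀ q, ENNReal.ofReal (jumpDiff F q ^ 2)
      ≤ c * (Λ.indicator 1 q.2.1 + Λ.indicator 1 q.2.2) := by
  obtain ⟨C, hC⟩ := hF.bdd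
  obtain ⟨Λ, hΛ, hFΛ⟩ := hF.local_ins
  refine ⟨ENNReal.ofReal ((C + C) ^ 2), Λ, ENNReal.ofReal_ne_top, hΛ, fun q => ?_⟩
  have hle : ENNReal.ofReal (jumpDiff F q ^ 2) ≤ ENNReal.ofReal ((C + C) ^ 2) * 1 := by
    rw [mul_one]
    refine ENNReal.ofReal_le_ofReal (sq_le_sq' ?_ ?_) <;>
    have h1 := abs_le.1 (hC (q.1.ins q.2.1)) <;> have h2 := abs_le.1 (hC (q.1.ins q.2.2)) <;>
    unfold jumpDiff <;> linarith
  by_cases h1 : q.2.1 ∈ Λ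
  · refine hle.trans (mul_le_mul_right ?_ _)
    rw [indicator_of_mem h1]
    exact le_self_add
  by_cases h2 : q.2.2 ∈ Λ
  · refine hle.trans (mul_le_mul_right ?_ _)
    rw [indicator_of_mem h2]
    exact le_add_self
  · rw [jumpDiff, hFΛ _ _ h1, hFΛ _ _ h2]
    simp

/-! ### Finiteness of the energy -/

theorem lintegral_kernel_mul_indicator {d : ℕ} {a : EucSp d → ℝ} (ha : Measurable a)
    {Λ : Set (EucSp d)} (hΛ : MeasurableSet Λ) :
    ∫⁻ w : EucSp d × EucSp d, ENNReal.ofReal (a (w.1 - w.2)) *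
        (Λ.indicator 1 w.1 + Λ.indicator 1 w.2) ∂(volume.prod volume)
      = 2 * ((∫⁻ x, ENNReal.ofReal (a x)) * volume Λ) := by
  have hk : Measurable fun w : EucSp d × EucSp d => ENNReal.ofReal (a (w.1 - w.2)) :=
    (ha.comp (measurable_fst.sub measurable_snd)).ennreal_ofReal
  have hi : Measurable (Λ.indicator (1 : EucSp d → ℝ≥0∞)) := measurable_one.indicator hΛ
  have h1 : Measurable fun w : EucSp d × EucSp d =>
      ENNReal.ofReal (a (w.1 - w.2)) * Λ.indicator 1 w.1 := hk.mul (hi.comp measurable_fst)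
  have h2 : Measurable fun w : EucSp d × EucSp d =>
      ENNReal.ofReal (a (w.1 - w.2)) * Λ.indicator 1 w.2 := hk.mul (hi.comp measurable_snd)
  have hu (x : EucSp d) : Measurable fun y => ENNReal.ofReal (a (x - y)) :=
    (ha.comp (measurable_const.sub measurable_id)).ennreal_ofReal
  have hv (y : EucSp d) : Measurable fun x => ENNReal.ofReal (a (x - y)) :=
    (ha.comp (measurable_id.sub measurable_const)).ennreal_ofReal
  have e1 : ∫⁻ w : EucSp d × EucSp d, ENNReal.ofReal (a (w.1 - w.2)) * Λ.indicator 1 w.1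
      ∂(volume.prod volume) = (∫⁻ x, ENNReal.ofReal (a x)) * volume Λ := by
    rw [lintegral_prod _ h1.aemeasurable]
    simp only [lintegral_mul_const _ (hu _),
      lintegral_sub_left_eq_self (fun y => ENNReal.ofReal (a y))]
    rw [lintegral_const_mul _ hi, lintegral_indicator_one hΛ]
  have e2 : ∫⁻ w : EucSp d × EucSp d, ENNReal.ofReal (a (w.1 - w.2)) * Λ.indicator 1 w.2
      ∂(volume.prod volume) = (∫⁻ x, ENNReal.ofReal (a x)) * volume Λ := by
    rw [lintegral_prod_symm _ h2.aemeasurable]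
    simp only [lintegral_mul_const _ (hv _),
      lintegral_sub_right_eq_self (fun y => ENNReal.ofReal (a y))]
    rw [lintegral_const_mul _ hi, lintegral_indicator_one hΛ]
  simp only [mul_add]
  rw [lintegral_add_left h1, e1, e2, two_mul]

theorem ennreal_mul_le_sq_add_sq (u v : ℝ≥0∞) : u * v ≤ u * u + v * v := by
  rcases le_total u v with h | h
  · exact (mul_le_mul_left h v).trans le_add_self
  · exact (mul_le_mul_right h u).trans le_self_add

theorem jumpEnergy_ne_top {d : ℕ} {s z B ξ : ℝ} {φ : EucSp d → EReal}
    {μ : Measure (Config d)} {k u : ∀ n : ℕ, (Fin n → EucSp d) → ℝ}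
    (hset : Setting d s z B ξ φ μ k u) {a : EucSp d → ℝ} (ha : GoodA a) {F : Config d → ℝ}
    (hF : IsBddLocal F) : jumpEnergy s z a φ μ F ≠ ∞ := by
  have := hset.prob
  have hs1 := hset.hs1
  have hs0 := hset.hs0
  have hs : s < 1 := by linarith
  obtain ⟨c, Λ, hc, hΛ, hle⟩ := hF.exists_jumpDiff_sq_le
  obtain ⟨K, hK, hKle⟩ := exists_lintegral_eexp_energy_le hset (p := 2 * (1 - s)) (by linarith)
    (by linarith)
  have hW (x : EucSp d) : Measurable fun γ => gibbsWeight s φ γ x * gibbsWeight s φ γ x :=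
    (measurable_gibbsWeight s hset.pp.meas measurable_id measurable_const).mul
      (measurable_gibbsWeight s hset.pp.meas measurable_id measurable_const)
  have hWle (x : EucSp d) : ∫⁻ γ, gibbsWeight s φ γ x * gibbsWeight s φ γ x ∂μ ≤ K := by
    simp only [gibbsWeight_mul_self hs]
    exact hKle x
  have hm : Measurable fun q => jumpWeight s z a φ q * ENNReal.ofReal (jumpDiff F q ^ 2) :=
    (measurable_jumpWeight s z ha.meas hset.pp.meas).mul
      ((measurable_jumpDiff hF.meas).pow_const 2).ennreal_ofReal
  have hin : Measurable fun w : EucSp d × EucSp d => ENNReal.ofReal (a (w.1 - w.2)) *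
      (Λ.indicator 1 w.1 + Λ.indicator (1 : EucSp d → ℝ≥0∞) w.2) := by
    have hi : Measurable (Λ.indicator (1 : EucSp d → ℝ≥0∞)) :=
      measurable_one.indicator hΛ.measurableSet
    exact (ha.meas.comp (measurable_fst.sub measurable_snd)).ennreal_ofReal.mul
      ((hi.comp measurable_fst).add (hi.comp measurable_snd))
  have hb (w : EucSp d × EucSp d) :
      ∫⁻ γ, jumpWeight s z a φ (γ, w) * ENNReal.ofReal (jumpDiff F (γ, w) ^ 2) ∂μ
        ≤ ENNReal.ofReal z * c * (K + K) * (ENNReal.ofReal (a (w.1 - w.2)) *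
          (Λ.indicator 1 w.1 + Λ.indicator 1 w.2)) := by
    set e : ℝ≥0∞ := ENNReal.ofReal (a (w.1 - w.2)) * (Λ.indicator 1 w.1 + Λ.indicator 1 w.2)
      with he
    calc _ ≤ ∫⁻ γ, ENNReal.ofReal z * c * e * (gibbsWeight s φ γ w.1 * gibbsWeight s φ γ w.1 +
            gibbsWeight s φ γ w.2 * gibbsWeight s φ γ w.2) ∂μ := by
          refine lintegral_mono fun γ => ?_
          refine (mul_le_mul_right (hle (γ, w)) _).trans ?_
          refine le_trans (le_of_eq ?_) (mul_le_mul_right (ennreal_mul_le_sq_add_sq _ _) _)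
          rw [he]
          simp only [jumpWeight]
          ring
      _ = ENNReal.ofReal z * c * e * ((∫⁻ γ, gibbsWeight s φ γ w.1 * gibbsWeight s φ γ w.1 ∂μ) +
            ∫⁻ γ, gibbsWeight s φ γ w.2 * gibbsWeight s φ γ w.2 ∂μ) := by
          refine (lintegral_const_mul _ ((hW w.1).add (hW w.2))).trans ?_
          exact congrArg _ (lintegral_add_left (hW w.1) _)
      _ ≤ ENNReal.ofReal z * c * e * (K + K) :=
          mul_le_mul_right (add_le_add (hWle w.1) (hWle w.2)) _
      _ = _ := by ring
  rw [jumpEnergy, lintegral_prod_symm _ hm.aemeasurable]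
  refine ne_top_of_le_ne_top ?_ (lintegral_mono hb)
  rw [lintegral_const_mul _ hin, lintegral_kernel_mul_indicator ha.meas hΛ.measurableSet]
  refine ENNReal.mul_ne_top (ENNReal.mul_ne_top (ENNReal.mul_ne_top ENNReal.ofReal_ne_top hc)
    (ENNReal.add_ne_top.2 ⟨hK, hK⟩)) (ENNReal.mul_ne_top ENNReal.ofNat_ne_top
      (ENNReal.mul_ne_top ?_ hΛ.measure_lt_top.ne))
  exact ha.int.lintegral_lt_top.ne

/-! ### Closability -/

theorem ae_gibbsWeight_eq_zero_or {d : ℕ} {s z : ℝ} (hs : s < 1) (hz : 0 < z)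
    {φ : EucSp d → EReal} (hφ : Measurable φ) {μ : Measure (Config d)} [SFinite μ]
    (hG : GNZ z φ μ) {P : Config d → Prop} (hP : ∀ᵐ γ ∂μ, P γ) :
    ∀ᵐ q ∂(μ.prod (volume : Measure (EucSp d))),
      gibbsWeight s φ q.1 q.2 = 0 ∨ P (q.1.ins q.2) := by
  obtain ⟨N, hPN, hN, hμN⟩ := exists_measurable_superset_of_null hP
  have hi : Measurable (N.indicator (1 : Config d → ℝ≥0∞)) := measurable_one.indicator hN
  have h0 : ∫⁻ γ, (∑' _ : γ.1, N.indicator (1 : Config d → ℝ≥0∞) γ) ∂μ = 0 := by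
    refine (lintegral_congr_ae ?_).trans lintegral_zero
    filter_upwards [compl_mem_ae_iff.2 hμN] with γ hγ
    rw [indicator_of_notMem hγ, tsum_zero]
  have hg := hG (fun γ _ => N.indicator 1 γ) (hi.comp measurable_fst)
  rw [h0] at hg
  have hm : Measurable fun q : Config d × EucSp d =>
      ENNReal.ofReal z * eexp (-(energy φ q.2 q.1.1)) * N.indicator 1 (q.1.ins q.2) :=
    ((measurable_eexp.comp (measurable_energy hφ measurable_fst measurable_snd).neg).const_mul
      _).mul (hi.comp (Config.measurable_ins measurable_fst measurable_snd))
  have hz' := (lintegral_prod (μ := μ) (ν := volume) _ hm.aemeasurable).trans hg.symm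
  rw [lintegral_eq_zero_iff hm] at hz'
  filter_upwards [hz'] with q hq
  rcases mul_eq_zero.1 hq with hq | hq
  · rcases mul_eq_zero.1 hq with hq | hq
    · exact absurd (ENNReal.ofReal_eq_zero.1 hq) (not_le.2 hz)
    · exact Or.inl (gibbsWeight_eq_zero_of_eexp_neg hs hq)
  · refine Or.inr (by_contra fun hPq => ?_)
    rw [indicator_of_mem (hPN hPq)] at hq
    exact one_ne_zero hq

theorem ae_jumpWeight_eq_zero_or {d : ℕ} {s z : ℝ} (hs : s < 1) (hz : 0 < z) (a : EucSp d → ℝ)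
    {φ : EucSp d → EReal} (hφ : Measurable φ) {μ : Measure (Config d)} [SFinite μ]
    (hG : GNZ z φ μ) {P : Config d → Prop} (hP : ∀ᵐ γ ∂μ, P γ) :
    ∀ᵐ q ∂(μ.prod ((volume : Measure (EucSp d)).prod volume)),
      jumpWeight s z a φ q = 0 ∨ (P (q.1.ins q.2.1) ∧ P (q.1.ins q.2.2)) := by
  have h := ae_gibbsWeight_eq_zero_or hs hz hφ hG hP
  have hx : Measure.QuasiMeasurePreserving
      (fun q : Config d × EucSp d × EucSp d => (q.1, q.2.1))
      (μ.prod (volume.prod volume)) (μ.prod volume) :=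
    QuasiMeasurePreserving.prodMap (.id μ) Measure.quasiMeasurePreserving_fst
  have hy : Measure.QuasiMeasurePreserving
      (fun q : Config d × EucSp d × EucSp d => (q.1, q.2.2))
      (μ.prod (volume.prod volume)) (μ.prod volume) :=
    QuasiMeasurePreserving.prodMap (.id μ) Measure.quasiMeasurePreserving_snd
  filter_upwards [hx.ae h, hy.ae h] with q h1 h2
  rcases h1 with h1 | h1
  · exact Or.inl (by rw [jumpWeight, h1]; simp)
  rcases h2 with h2 | h2
  · exact Or.inl (by rw [jumpWeight, h2]; simp)
  exact Or.inr ⟨h1, h2⟩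

theorem jumpEnergy_le_liminf {d : ℕ} {s z : ℝ} (hs : s < 1) (hz : 0 < z) {a : EucSp d → ℝ}
    (ha : Measurable a) {φ : EucSp d → EReal} (hφ : Measurable φ) {μ : Measure (Config d)}
    [SFinite μ] (hG : GNZ z φ μ) {F : Config d → ℝ} (hF : Measurable F) {G : ℕ → Config d → ℝ}
    (hGm : ∀ n, Measurable (G n))
    (hlim : ∀ᵐ γ ∂μ, Tendsto (fun n => G n γ) atTop (𝓝 0)) :
    jumpEnergy s z a φ μ F
      ≤ liminf (fun n => jumpEnergy s z a φ μ fun γ => F γ - G n γ) atTop := by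
  refine le_trans ?_ (lintegral_liminf_le fun n => (measurable_jumpWeight s z ha hφ).mul
    ((measurable_jumpDiff (hF.sub (hGm n))).pow_const 2).ennreal_ofReal)
  refine (lintegral_congr_ae ?_).le
  filter_upwards [ae_jumpWeight_eq_zero_or hs hz a hφ hG hlim] with q hq
  rcases hq with hq | ⟨hx, hy⟩
  · simp [hq]
  · refine (Tendsto.liminf_eq ?_).symm
    refine ENNReal.Tendsto.const_mul (ENNReal.tendsto_ofReal (Tendsto.pow ?_ 2))
      (Or.inr (jumpWeight_ne_top hs z a φ q))
    have := (hy.const_sub (F (q.1.ins q.2.2))).sub (hx.const_sub (F (q.1.ins q.2.1)))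
    rwa [sub_zero, sub_zero] at this

theorem exists_subseq_tendsto_ae_of_integral_sq {Ω : Type*} [MeasurableSpace Ω] {μ : Measure Ω}
    {F : ℕ → Ω → ℝ} (hF : ∀ n, Measurable (F n)) (hint : ∀ n, Integrable (fun ω => F n ω ^ 2) μ)
    (hL2 : Tendsto (fun n => ∫ ω, F n ω ^ 2 ∂μ) atTop (𝓝 0)) :
    ∃ ns : ℕ → ℕ, StrictMono ns ∧ ∀ᵐ ω ∂μ, Tendsto (fun i => F (ns i) ω) atTop (𝓝 0) := by
  have hm : TendstoInMeasure μ (fun n ω => F n ω ^ 2) atTop (fun _ => 0) := by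
    refine tendstoInMeasure_of_tendsto_eLpNorm (p := 1) one_ne_zero
      (fun n => ((hF n).pow_const 2).aestronglyMeasurable) aestronglyMeasurable_const ?_
    have he (n : ℕ) : eLpNorm ((fun ω => F n ω ^ 2) - fun _ => 0) 1 μ
        = ENNReal.ofReal (∫ ω, F n ω ^ 2 ∂μ) := by
      rw [eLpNorm_one_eq_lintegral_enorm, ofReal_integral_eq_lintegral_ofReal (hint n)
        (ae_of_all _ fun ω => sq_nonneg _)]
      refine lintegral_congr fun ω => ?_
      rw [Pi.sub_apply, sub_zero, Real.enorm_of_nonneg (sq_nonneg _)]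
    simp only [he]
    simpa using ENNReal.tendsto_ofReal hL2
  obtain ⟨ns, hns, hae⟩ := hm.exists_seq_tendsto_ae
  refine ⟨ns, hns, ?_⟩
  filter_upwards [hae] with ω hω
  have h := (Real.continuous_sqrt.tendsto 0).comp hω
  rw [Real.sqrt_zero] at h
  rw [tendsto_zero_iff_abs_tendsto_zero]
  exact h.congr fun i => Real.sqrt_sq_eq_abs _

/-- the Kawasaki form `(E_K, FC_b(C_0(ℝ^d),Γ))` is closable on `L²(Γ,μ)`:
if `F_n → 0` in `L²(Γ,μ)` and `E_K(F_n - F_m, F_n - F_m) → 0` as `n,m → ∞`, then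
`E_K(F_n,F_n) → 0`. -/
theorem statement6 (d : ℕ) (s z B ξ : ℝ) (φ : EucSp d → EReal) (μ : Measure (Config d))
    (k u : ∀ n : ℕ, (Fin n → EucSp d) → ℝ) (hset : Setting d s z B ξ φ μ k u)
    (a : EucSp d → ℝ) (ha : GoodA a)
    (F : ℕ → Config d → ℝ) (hF : ∀ n, Cyl (F n))
    (hL2 : Tendsto (fun n => ∫ γ, (F n γ) ^ 2 ∂μ) atTop (nhds 0))
    (hCauchy : Tendsto (fun p : ℕ × ℕ =>
        kawasakiForm s a φ μ (fun γ => F p.1 γ - F p.2 γ) (fun γ => F p.1 γ - F p.2 γ))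
      atTop (nhds 0)) :
    Tendsto (fun n => kawasakiForm s a φ μ (F n) (F n)) atTop (nhds 0) := by
  have := hset.prob
  have hs1 := hset.hs1
  have hs : s < 1 := by linarith
  have hloc (n : ℕ) : IsBddLocal (F n) := (hF n).isBddLocal
  have hform {G : Config d → ℝ} (hG : IsBddLocal G) : kawasakiForm s a φ μ G G
      = (1 / 2) * (jumpEnergy s z a φ μ G).toReal :=
    kawasakiForm_eq hset.hd hs ha.meas ha.nonneg hset.pp.meas hset.gnz hG.meas
      (jumpEnergy_ne_top hset ha hG)
  have hint (n : ℕ) : Integrable (fun γ => F n γ ^ 2) μ := by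
    obtain ⟨C, hC⟩ := (hloc n).bdd
    refine Integrable.of_bound ((hloc n).meas.pow_const 2).aestronglyMeasurable (C ^ 2)
      (ae_of_all _ fun γ => ?_)
    rw [norm_pow]
    exact pow_le_pow_left₀ (norm_nonneg _) (hC γ) 2
  obtain ⟨ns, hns, hae⟩ := exists_subseq_tendsto_ae_of_integral_sq (fun n => (hloc n).meas) hint hL2
  rw [Metric.tendsto_atTop]
  intro ε hε
  obtain ⟨⟨N, M⟩, hNM⟩ := Metric.tendsto_atTop.1 hCauchy (ε / 2) (by linarith)
  refine ⟨N, fun n hn => ?_⟩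
  have hle : jumpEnergy s z a φ μ (F n) ≤ ENNReal.ofReal ε := by
    refine (jumpEnergy_le_liminf hs hset.hz ha.meas hset.pp.meas hset.gnz (hloc n).meas
      (fun i => (hloc (ns i)).meas) hae).trans (liminf_le_of_frequently_le' ?_)
    refine Eventually.frequently ?_
    filter_upwards [eventually_ge_atTop M] with i hi
    have hsub := (hloc n).sub (hloc (ns i))
    have h := hNM (n, ns i) ⟨hn, hi.trans (hns.id_le i)⟩
    rw [Real.dist_eq, sub_zero] at h
    have h' := (le_abs_self _).trans h.le
    rw [hform hsub] at h'
    rw [← ENNReal.ofReal_toReal (jumpEnergy_ne_top hset ha hsub)]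
    exact ENNReal.ofReal_le_ofReal (by linarith)
  have hr : (jumpEnergy s z a φ μ (F n)).toReal ≤ ε := ENNReal.toReal_le_of_le_ofReal hε.le hle
  have h0 : 0 ≤ (jumpEnergy s z a φ μ (F n)).toReal := ENNReal.toReal_nonneg
  rw [Real.dist_eq, sub_zero, hform (hloc n), abs_of_nonneg (by linarith)]
  linarith

end
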